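/- Let K be a field, view K[x_1,…,x_n] as (K[x_1])[x̃] with x̃ = (x_2,…,x_n), and fix a monomial ordering on the x̃-monomials. Let I be an ideal of K[x_1,…,x_n] and suppose some χ ∈ I ∩ K[x_1] factors as χ = d·e with d ∈ K[x_1] nonconstant and gcd(d, e) = 1. Let σ_d: (K[x_1])[x̃] → (K[x_1]/⟨d⟩)[x̃] be the coefficientwise projection. Then for every nonzero h ∈ σ_d(I) there exists f ∈ I with σ_d(f) = h and σ_d(lc(f)) ≠ 0. -/

import Mathlib

open MvPolynomial

/-- A monomial ordering on the monomials (exponent vectors) in `m` variables: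
a well-ordering compatible with addition of exponents. -/
structure MonomialOrdering (m : ℕ) where
  lin : LinearOrder (Fin m →₀ ℕ)
  wf : WellFounded lin.lt
  add_lt_add : ∀ a b c : Fin m →₀ ℕ, lin.lt a b → lin.lt (a + c) (b + c)

variable {m : ℕ}

open Classical in
/-- Leading monomial of `f` (junk value `0` for `f = 0`). -/
noncomputable def lmon {R : Type*} [CommRing R] (mo : MonomialOrdering m)
    (f : MvPolynomial (Fin m) R) : Fin m →₀ ℕ :=
  letI := mo.lin
  if h : f = 0 then 0
  else f.support.max' (Finset.nonempty_iff_ne_empty.mpr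
    (fun he => h (MvPolynomial.support_eq_empty.mp he)))

/-- Leading coefficient of `f`. -/
noncomputable def lcoeff {R : Type*} [CommRing R] (mo : MonomialOrdering m)
    (f : MvPolynomial (Fin m) R) : R :=
  f.coeff (lmon mo f)

/-- Leading term of `f`, as a polynomial. -/
noncomputable def lterm {R : Type*} [CommRing R] (mo : MonomialOrdering m)
    (f : MvPolynomial (Fin m) R) : MvPolynomial (Fin m) R :=
  MvPolynomial.monomial (lmon mo f) (lcoeff mo f)

/-- `f` is a nonconstant polynomial, i.e. `f ∉ R`. -/
def Nonconst {R : Type*} [CommRing R] (f : MvPolynomial (Fin m) R) : Prop :=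
  ∀ c : R, f ≠ MvPolynomial.C c

theorem lcoeff_ne_zero {R : Type*} [CommRing R] (mo : MonomialOrdering m)
    {f : MvPolynomial (Fin m) R} (hf : f ≠ 0) : lcoeff mo f ≠ 0 := by
  let := mo.lin
  rw [_root_.lcoeff, ← MvPolynomial.mem_support_iff, lmon, dif_neg hf]
  exact Finset.max'_mem _ _

/-- The terms of `g` whose coefficients survive modulo `d` agree with `g` up to a multiple
of `d`. -/
theorem exists_sub_eq_C_mul_of_coeff_not_dvd {σ R : Type*} [CommRing R] (d : R)
    (g : MvPolynomial σ R) :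
    ∃ g₀ q : MvPolynomial σ R, g - g₀ = C d * q ∧ ∀ s, coeff s g₀ ≠ 0 → ¬ d ∣ coeff s g₀ := by
  classical
  let g₀ := ∑ s ∈ g.support with ¬ d ∣ coeff s g, monomial s (coeff s g)
  have hg₀ (s) : coeff s g₀ = if d ∣ coeff s g then 0 else coeff s g := by
    by_cases hs : d ∣ coeff s g <;> simp +contextual [g₀, coeff_sum, coeff_monomial, hs]
  have hdvd : C d ∣ g - g₀ := by
    rw [C_dvd_iff_dvd_coeff]
    intro s
    rw [coeff_sub, hg₀]
    split_ifs with hs <;> simp [hs]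
  obtain ⟨q, hq⟩ := hdvd
  refine ⟨g₀, q, hq, fun s hs => ?_⟩
  rw [hg₀] at hs ⊢
  split_ifs with h <;> simp_all

/-- Let `I` be an ideal of `(K[x₁])[x̃]`, suppose some `χ ∈ I ∩ K[x₁]` factors as
`χ = d·e` with `d` nonconstant and `gcd(d, e) = 1`, and let `σ_d` be the coefficientwise
projection modulo `d`.  Then every nonzero element of `σ_d(I)` is the image of some
`f ∈ I` whose leading coefficient does not vanish modulo `d`. -/
theorem image_ideal_represented_by_nonvanishing_leadCoeff {K : Type*} [Field K]
    (mo : MonomialOrdering m)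
    (I : Ideal (MvPolynomial (Fin m) (Polynomial K)))
    (χ d e : Polynomial K)
    (hχI : MvPolynomial.C χ ∈ I)
    (hfac : χ = d * e)
    (hd : 0 < d.natDegree)
    (hcop : IsCoprime d e)
    (h : MvPolynomial (Fin m) (Polynomial K ⧸ Ideal.span {d}))
    (hmem : ∃ g ∈ I,
      MvPolynomial.map (Ideal.Quotient.mk (Ideal.span {d})) g = h)
    (hne : h ≠ 0) :
    ∃ f ∈ I,
      MvPolynomial.map (Ideal.Quotient.mk (Ideal.span {d})) f = h ∧
      Ideal.Quotient.mk (Ideal.span {d}) (lcoeff mo f) ≠ 0 := by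
  obtain ⟨g, hgI, rfl⟩ := hmem
  obtain ⟨a, b, hab⟩ := hcop
  obtain ⟨g₀, q, hq, hg₀⟩ := exists_sub_eq_C_mul_of_coeff_not_dvd d g
  have hd0 : Ideal.Quotient.mk (Ideal.span {d}) d = 0 :=
    Ideal.Quotient.eq_zero_iff_mem.mpr (Ideal.mem_span_singleton_self d)
  have hbe : Ideal.Quotient.mk (Ideal.span {d}) (b * e) = 1 := by
    have := congrArg (Ideal.Quotient.mk (Ideal.span {d})) hab
    simpa only [map_add, map_mul, hd0, mul_zero, zero_add, map_one] using this
  have hmap : map (Ideal.Quotient.mk (Ideal.span {d})) (C (b * e) * g₀) =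
      map (Ideal.Quotient.mk (Ideal.span {d})) g := by
    have := congrArg (map (Ideal.Quotient.mk (Ideal.span {d}))) hq
    rw [map_sub, map_mul, map_C, hd0, C_0, zero_mul, sub_eq_zero] at this
    rw [map_mul, map_C, hbe, C_1, one_mul, this]
  refine ⟨C (b * e) * g₀, ?_, hmap, ?_⟩
  · have : C (b * e) * g₀ = C (b * e) * g - C b * q * C χ := by
      rw [hfac, C_mul, C_mul]
      linear_combination -(C b * C e) * hq
    rw [this]
    exact I.sub_mem (I.mul_mem_left _ hgI) (I.mul_mem_left _ hχI)
  · have hf : C (b * e) * g₀ ≠ 0 := fun h0 => hne (by rw [← hmap, h0, map_zero])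
    have hlc := lcoeff_ne_zero mo hf
    rw [_root_.lcoeff, coeff_C_mul] at hlc ⊢
    rw [map_mul, hbe, one_mul, Ne, Ideal.Quotient.eq_zero_iff_mem, Ideal.mem_span_singleton]
    exact hg₀ _ (right_ne_zero_of_mul hlc)
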